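/- (Greedy with an additive ε'-approximate incremental oracle under a p-system constraint.) Let (E, I) be a p-system with p ≥ 1, let F : 2^E → ℝ be a non-negative monotone submodular function with F(∅) = 0, and let S* maximize F over I. Let ε ∈ [0, 1] and ε' ≤ ε/(2pk). Suppose S_1 = ∅ and, for j = 1, …, k, letting A_j = {e ∈ E \ S_j : S_j ∪ {e} ∈ I}, the element e_j ∈ A_j satisfies F_{S_j}(e_j) ≥ F_{S_j}(e) − 2ε'·F(S*) for every e ∈ A_j, and S_{j+1} = S_j ∪ {e_j}; suppose moreover that the output S = S_{k+1} is an inclusion-maximal member of I. Then F(S) ≥ ((1 − ε)/(p + 1))·F(S*). -/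

import Mathlib

open Finset

def Submodular {E : Type*} [DecidableEq E] (F : Finset E → ℝ) : Prop :=
  ∀ S T : Finset E, S ⊆ T → ∀ e ∉ T,
    F (insert e T) - F T ≤ F (insert e S) - F S

def MonotoneSetFn {E : Type*} (F : Finset E → ℝ) : Prop :=
  ∀ S T : Finset E, S ⊆ T → F S ≤ F T

def IndepSystem {E : Type*} (I : Set (Finset E)) : Prop :=
  ∅ ∈ I ∧ ∀ A ∈ I, ∀ B ⊆ A, B ∈ I

def IsBasisIn {E : Type*} (I : Set (Finset E)) (E' A : Finset E) : Prop :=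
  A ∈ I ∧ A ⊆ E' ∧ ∀ A' ∈ I, A ⊆ A' → A' ⊆ E' → A' = A

def PSystem {E : Type*} (I : Set (Finset E)) (p : ℕ) : Prop :=
  IndepSystem I ∧
    ∀ E' A B : Finset E, IsBasisIn I E' A → IsBasisIn I E' B → A.card ≤ p * B.card

theorem exists_isBasisIn_superset {E : Type*} {I : Set (Finset E)} {E' T : Finset E}
    (hT : T ∈ I) (hTE : T ⊆ E') : ∃ B, T ⊆ B ∧ IsBasisIn I E' B := by
  classical
  obtain ⟨B, hTB, hB⟩ := (E'.powerset.filter (· ∈ I)).exists_le_maximal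
    (a := T) (by simp [hT, hTE])
  have hmem : B ⊆ E' ∧ B ∈ I := by simpa using hB.prop
  refine ⟨B, hTB, hmem.2, hmem.1, fun A hA hBA hAE => ?_⟩
  exact (hB.eq_of_le (by simp [hA, hAE]) hBA).symm

/-- In a `p`-system, an independent set none of whose elements can be added to `A` has at most
`p * A.card` elements. -/
theorem PSystem.card_le_of_forall_insert_notMem {E : Type*} [DecidableEq E]
    {I : Set (Finset E)} {p : ℕ} (hI : PSystem I p) {A T : Finset E} (hA : A ∈ I) (hT : T ∈ I)
    (h : ∀ x ∈ T, insert x A ∉ I) : T.card ≤ p * A.card := by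
  obtain ⟨B, hTB, hB⟩ := exists_isBasisIn_superset hT (subset_union_right (s₁ := A))
  refine (card_le_card hTB).trans (hI.2 (A ∪ T) B A hB ⟨hA, subset_union_left, ?_⟩)
  intro A' hA' hAA' hA'E
  refine Subset.antisymm (fun x hx => ?_) hAA'
  by_contra hxA
  have hxT : x ∈ T := (mem_union.1 (hA'E hx)).resolve_left hxA
  exact h x hxT (hI.1.2 A' hA' _ (insert_subset hx hAA'))

theorem Submodular.union_sub_le_sum {E : Type*} [DecidableEq E] {F : Finset E → ℝ}
    (hsub : Submodular F) (A T : Finset E) (hAT : Disjoint A T) :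
    F (A ∪ T) - F A ≤ ∑ x ∈ T, (F (insert x A) - F A) := by
  induction T using Finset.induction_on with
  | empty => simp
  | insert x T hx ih =>
    rw [disjoint_insert_right] at hAT
    rw [sum_insert hx, union_insert]
    have := hsub A (A ∪ T) subset_union_left x (by simp [hAT.1, hx])
    linarith [ih hAT.2]

/-- The charging argument: along a chain `s` of independent sets with `s m` of size `m` whose
greedy increments are optimal up to `η`, an independent set `T` of at most `p * m` elements outside
the final set `A` has total marginal value over `A` at most `p * (F (s m) + m * η)`. -/
theorem PSystem.sum_marginal_le {E : Type*} [DecidableEq E] {I : Set (Finset E)} {p : ℕ}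
    (hI : PSystem I p) {F : Finset E → ℝ} (hsub : Submodular F) (h0 : 0 ≤ F ∅)
    {s : ℕ → Finset E} {k : ℕ} {η : ℝ} (hη : 0 ≤ η) {A : Finset E}
    (hs0 : s 0 = ∅) (hmem : ∀ m ≤ k, s m ∈ I) (hcard : ∀ m ≤ k, (s m).card = m)
    (hsA : ∀ m ≤ k, s m ⊆ A) (hle : ∀ m < k, F (s m) ≤ F (s (m + 1)))
    (hgreedy : ∀ m < k, ∀ x, x ∉ s m → insert x (s m) ∈ I →
      F (insert x (s m)) - F (s m) ≤ F (s (m + 1)) - F (s m) + η) :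
    ∀ m ≤ k, ∀ T ∈ I, Disjoint A T → T.card ≤ p * m →
      ∑ x ∈ T, (F (insert x A) - F A) ≤ p * (F (s m) + m * η) := by
  classical
  intro m
  induction m with
  | zero =>
    intro _ T _ _ hT
    have : T = ∅ := by simpa using hT
    subst this
    simpa [hs0] using mul_nonneg (Nat.cast_nonneg p) h0
  | succ m ih =>
    intro hm T hT hAT hTc
    have hm' : m ≤ k := by omega
    obtain ⟨R, hR, hRp, hRT⟩ : ∃ R ⊆ T.filter (fun x => insert x (s m) ∈ I),
        R.card ≤ p ∧ (T \ R).card ≤ p * m := by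
      rcases le_total (T.filter (fun x => insert x (s m) ∈ I)).card p with h | h
      · refine ⟨_, Subset.rfl, h, ?_⟩
        have := hI.card_le_of_forall_insert_notMem (hmem m hm')
          (hI.1.2 T hT (T \ T.filter fun x => insert x (s m) ∈ I) sdiff_subset) fun x hx hxI => by
            simp only [mem_sdiff, mem_filter] at hx
            exact hx.2 ⟨hx.1, hxI⟩
        rwa [hcard m hm'] at this
      · obtain ⟨R, hR, hRc⟩ := exists_subset_card_eq h
        refine ⟨R, hR, hRc.le, ?_⟩
        rw [card_sdiff_of_subset (hR.trans (filter_subset _ _)), hRc]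
        rw [mul_add_one] at hTc
        omega
    have hRT' : R ⊆ T := hR.trans (filter_subset _ _)
    have hrest := ih hm' (T \ R) (hI.1.2 T hT _ sdiff_subset)
      (hAT.mono_right sdiff_subset) hRT
    have hbound : ∀ x ∈ R, F (insert x A) - F A ≤ F (s (m + 1)) - F (s m) + η := by
      intro x hx
      have hxA : x ∉ A := disjoint_right.1 hAT (hRT' hx)
      exact (hsub _ _ (hsA m hm') x hxA).trans (hgreedy m hm x
        (fun h => hxA (hsA m hm' h)) (mem_filter.1 (hR hx)).2)
    have hpos : 0 ≤ F (s (m + 1)) - F (s m) + η := by linarith [hle m hm]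
    have hR_sum : ∑ x ∈ R, (F (insert x A) - F A) ≤ p * (F (s (m + 1)) - F (s m) + η) := by
      refine (sum_le_card_nsmul _ _ _ hbound).trans ?_
      rw [nsmul_eq_mul]
      exact mul_le_mul_of_nonneg_right (by exact_mod_cast hRp) hpos
    rw [← sum_sdiff hRT']
    push_cast
    linarith

/-- Greedy with an additive ε'-approximate incremental oracle, p-system
constraint: under a p-system, greedy steps chosen within additive error `2ε'·F(S*)` with
`ε' ≤ ε/(2pk)` produce, upon reaching a maximal independent set, a solution with
`F(S) ≥ ((1−ε)/(p+1))·F(S*)`. -/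
theorem greedy_additive_oracle_psystem {E : Type*} [Fintype E] [DecidableEq E]
    (I : Set (Finset E)) (p : ℕ) (hp : 1 ≤ p) (hI : PSystem I p)
    (F : Finset E → ℝ)
    (hnonneg : ∀ S, 0 ≤ F S) (hmono : MonotoneSetFn F) (hsub : Submodular F)
    (hempty : F ∅ = 0)
    (Sstar : Finset E) (hSstar_mem : Sstar ∈ I)
    (hSstar_opt : ∀ T ∈ I, F T ≤ F Sstar)
    (k : ℕ) (hk : 1 ≤ k)
    (ε ε' : ℝ) (hε0 : 0 ≤ ε) (hε1 : ε ≤ 1) (hε' : ε' ≤ ε / (2 * p * k))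
    (S : ℕ → Finset E) (e : ℕ → E)
    (hS1 : S 1 = ∅)
    (hstep : ∀ j, 1 ≤ j → j ≤ k →
      (e j ∉ S j ∧ insert (e j) (S j) ∈ I) ∧
      S (j + 1) = insert (e j) (S j) ∧
      ∀ x : E, x ∉ S j → insert x (S j) ∈ I →
        F (insert (e j) (S j)) - F (S j) ≥
          (F (insert x (S j)) - F (S j)) - 2 * ε' * F Sstar)
    (hmax : IsBasisIn I Finset.univ (S (k + 1))) :
    F (S (k + 1)) ≥ ((1 - ε) / (p + 1)) * F Sstar := by
  have hchain : ∀ m ≤ k, S (m + 1) ∈ I ∧ (S (m + 1)).card = m := by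
    intro m
    induction m with
    | zero => simp [hS1, hI.1.1]
    | succ m ih =>
      intro hm
      obtain ⟨⟨hnot, hin⟩, hS, -⟩ := hstep (m + 1) (by omega) hm
      rw [hS, card_insert_of_notMem hnot, (ih (by omega)).2]
      exact ⟨hin, rfl⟩
  have hstep_sub : ∀ m < k, S (m + 1) ⊆ S (m + 1 + 1) := by
    intro m hm
    rw [(hstep (m + 1) (by omega) hm).2.1]
    exact subset_insert _ _
  have hsubset : ∀ m ≤ k, S (m + 1) ⊆ S (k + 1) := fun m hm =>
    Nat.decreasingInduction (motive := fun m _ => S (m + 1) ⊆ S (k + 1))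
      (fun m hm ih => (hstep_sub m hm).trans ih) Subset.rfl hm
  have hk0 : (0 : ℝ) < k := by exact_mod_cast hk
  have hp0 : (0 : ℝ) < p := by exact_mod_cast hp
  have herror : 2 * ε' * F Sstar ≤ ε / (p * k) * F Sstar := by
    refine mul_le_mul_of_nonneg_right ?_ (hnonneg _)
    calc 2 * ε' ≤ 2 * (ε / (2 * p * k)) := by linarith
      _ = ε / (p * k) := by field_simp
  have hdisj : Disjoint (S (k + 1)) (Sstar \ S (k + 1)) := disjoint_sdiff
  have hT : Sstar \ S (k + 1) ∈ I := hI.1.2 _ hSstar_mem _ sdiff_subset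
  have hTcard : (Sstar \ S (k + 1)).card ≤ p * k := by
    have := hI.card_le_of_forall_insert_notMem hmax.1 hT fun x hx hxI =>
      (mem_sdiff.1 hx).2 (hmax.2.2 _ hxI (subset_insert _ _) (subset_univ _) ▸ mem_insert_self _ _)
    rwa [(hchain k le_rfl).2] at this
  have hcharge := hI.sum_marginal_le hsub hempty.ge (s := fun m => S (m + 1)) (k := k)
    (η := ε / (p * k) * F Sstar) (mul_nonneg (by positivity) (hnonneg _)) hS1
    (fun m hm => (hchain m hm).1) (fun m hm => (hchain m hm).2) hsubset
    (fun m hm => hmono _ _ (hstep_sub m hm))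
    (fun m hm x hx hxI => by
      obtain ⟨-, hS, hopt⟩ := hstep (m + 1) (by omega) hm
      have := hopt x hx hxI
      rw [← hS] at this
      linarith)
    k le_rfl _ hT hdisj hTcard
  have hunion := hsub.union_sub_le_sum _ _ hdisj
  rw [union_sdiff_self_eq_union] at hunion
  have hopt_le := hmono Sstar (S (k + 1) ∪ Sstar) subset_union_right
  have hsimp : (p : ℝ) * (F (S (k + 1)) + k * (ε / (p * k) * F Sstar)) =
      p * F (S (k + 1)) + ε * F Sstar := by
    field_simp
  rw [ge_iff_le, div_mul_eq_mul_div, div_le_iff₀ (by positivity)]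
  simp only [hsimp] at hcharge
  linarith
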